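/- Let N be a closed two-sided ideal of a C*-algebra A, where A and B are 𝔄-bimodules with compatible actions and N is a submodule. Then the canonical map N ⊗_{𝔄,max} B → A ⊗_{𝔄,max} B is an isometric embedding. -/

import Mathlib

open scoped TensorProduct
noncomputable section

/-- A compatible action of a C*-algebra `𝔄` on a C*-algebra `A` (Amini):
bilinear, bounded, compatible with multiplication and star. -/
structure CompatibleAction (𝔄 A : Type*) [NonUnitalNormedRing 𝔄] [StarRing 𝔄]
    [NormedSpace ℂ 𝔄] [NonUnitalNormedRing A] [StarRing A] [NormedSpace ℂ A] where
  l : 𝔄 →ₗ[ℂ] A →ₗ[ℂ] A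
  r : A →ₗ[ℂ] 𝔄 →ₗ[ℂ] A
  bound : ℝ
  bound_pos : 0 < bound
  norm_l : ∀ α a, ‖l α a‖ ≤ bound * ‖a‖ * ‖α‖
  norm_r : ∀ a α, ‖r a α‖ ≤ bound * ‖a‖ * ‖α‖
  l_mul : ∀ α a b, l α (a * b) = (l α a) * b
  mul_r : ∀ a b α, r (a * b) α = a * (r b α)
  star_l : ∀ α a, star (l α a) = r (star a) (star α)
  star_r : ∀ a α, star (r a α) = l (star α) (star a)

/-- The action is commutative: `α • a = a • α`. -/
def CompatibleAction.IsCommutative {𝔄 A : Type*} [NonUnitalNormedRing 𝔄] [StarRing 𝔄]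
    [NormedSpace ℂ 𝔄] [NonUnitalNormedRing A] [StarRing A] [NormedSpace ℂ A]
    (act : CompatibleAction 𝔄 A) : Prop :=
  ∀ (α : 𝔄) (a : A), act.l α a = act.r a α

/-- A C*-seminorm on a complex *-algebra, with the star operation given explicitly
(to accommodate algebraic tensor products, where the star is `tstar`). -/
structure CstarSeminorm (R : Type*) [NonUnitalRing R] [Module ℂ R] (st : R → R) where
  ν : R → ℝ
  nonneg : ∀ x, 0 ≤ ν x
  add_le : ∀ x y, ν (x + y) ≤ ν x + ν y
  smul_eq : ∀ (c : ℂ) (x : R), ν (c • x) = ‖c‖ * ν x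
  mul_le : ∀ x y, ν (x * y) ≤ ν x * ν y
  cstar : ∀ x, ν (st x * x) = ν x ^ 2

def CstarSeminorm.IsNorm {R : Type*} [NonUnitalRing R] [Module ℂ R] {st : R → R}
    (p : CstarSeminorm R st) : Prop := ∀ x, p.ν x = 0 → x = 0

/-- `γ` is the maximal C*-norm: it is a norm and dominates every C*-seminorm. -/
def CstarSeminorm.IsMax {R : Type*} [NonUnitalRing R] [Module ℂ R] {st : R → R}
    (γ : CstarSeminorm R st) : Prop :=
  γ.IsNorm ∧ ∀ p : CstarSeminorm R st, ∀ x, p.ν x ≤ γ.ν x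

/-- `γ` is the minimal C*-norm: it is a norm dominated by every C*-norm. -/
def CstarSeminorm.IsMin {R : Type*} [NonUnitalRing R] [Module ℂ R] {st : R → R}
    (γ : CstarSeminorm R st) : Prop :=
  γ.IsNorm ∧ ∀ p : CstarSeminorm R st, p.IsNorm → ∀ x, γ.ν x ≤ p.ν x

/-- Quotient seminorm `‖x + I‖ = inf_{i ∈ I} ν (x + i)`. -/
def quotNorm {R : Type*} [AddCommGroup R] (ν : R → ℝ) (I : Set R) (x : R) : ℝ :=
  sInf ((fun i => ν (x + i)) '' I)

/-- The two-sided ideal (as a `ℂ`-submodule) generated by a set `G`. -/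
def idealSpan (R : Type*) [NonUnitalRing R] [Module ℂ R] (G : Set R) : Submodule ℂ R :=
  Submodule.span ℂ
    {y | ∃ g ∈ G, y = g ∨ (∃ u, y = u * g) ∨ (∃ v, y = g * v) ∨ ∃ u v, y = u * g * v}

/-- The star operation on the algebraic tensor product `A ⊗[ℂ] B`,
`(a ⊗ b)* = a* ⊗ b*` (conjugate-linear, hence only an `AddMonoidHom`). -/
def tstar (A B : Type*) [Ring A] [StarRing A] [Algebra ℂ A] [StarModule ℂ A]
    [Ring B] [StarRing B] [Algebra ℂ B] [StarModule ℂ B] : A ⊗[ℂ] B →+ A ⊗[ℂ] B :=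
  TensorProduct.liftAddHom
    { toFun := fun a =>
        { toFun := fun b => star a ⊗ₜ[ℂ] star b
          map_zero' := by simp
          map_add' := fun b c => by simp [star_add, TensorProduct.tmul_add] }
      map_zero' := by ext b; simp
      map_add' := fun a c => by ext b; simp [star_add, TensorProduct.add_tmul] }
    (fun c a b => by simp [star_smul, TensorProduct.smul_tmul, TensorProduct.tmul_smul])

section TensorIdeal

variable {𝔄 A B : Type*}
  [NormedRing 𝔄] [StarRing 𝔄] [NormedAlgebra ℂ 𝔄]
  [NormedRing A] [StarRing A] [NormedAlgebra ℂ A]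
  [NormedRing B] [StarRing B] [NormedAlgebra ℂ B]

/-- Generators `a·α ⊗ b − a ⊗ α·b` of the module ideal `I_{A,B}`. -/
def tensorGens (actA : CompatibleAction 𝔄 A) (actB : CompatibleAction 𝔄 B) :
    Set (A ⊗[ℂ] B) :=
  {x | ∃ (α : 𝔄) (a : A) (b : B), x = (actA.r a α) ⊗ₜ[ℂ] b - a ⊗ₜ[ℂ] (actB.l α b)}

/-- The ideal `I_{A,B}` of `A ⊙ B` generated by `a·α ⊗ b − a ⊗ α·b`. -/
def moduleIdeal (actA : CompatibleAction 𝔄 A) (actB : CompatibleAction 𝔄 B) :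
    Submodule ℂ (A ⊗[ℂ] B) :=
  idealSpan _ (tensorGens actA actB)

end TensorIdeal

/-- Algebraic positivity in a *-ring: `x = y* y`. -/
def StarPos {R : Type*} [Mul R] [Star R] (x : R) : Prop := ∃ y, x = star y * y

/-- A completely positive map: positive matrices over `A` map to positive matrices over `B`. -/
def IsCP {A B : Type*} [NonUnitalRing A] [StarRing A] [NonUnitalRing B] [StarRing B]
    (u : A → B) : Prop :=
  ∀ (n : ℕ) (M : Matrix (Fin n) (Fin n) A), StarPos M → StarPos (M.map u)

/-- An `𝔄`-bimodule map. -/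
def IsModuleMap {𝔄 A B : Type*} [NonUnitalNormedRing 𝔄] [StarRing 𝔄] [NormedSpace ℂ 𝔄]
    [NonUnitalNormedRing A] [StarRing A] [NormedSpace ℂ A]
    [NonUnitalNormedRing B] [StarRing B] [NormedSpace ℂ B]
    (actA : CompatibleAction 𝔄 A) (actB : CompatibleAction 𝔄 B) (u : A → B) : Prop :=
  (∀ α a, u (actA.l α a) = actB.l α (u a)) ∧ ∀ a α, u (actA.r a α) = actB.r (u a) α

open Filter Topology

section ClosedIdeal

variable {A : Type*} [CStarAlgebra A]

lemma exists_isSelfAdjoint_norm_sub_mul_lt (n : A) {ε : ℝ} (hε : 0 < ε) :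
    ∃ c : A, IsSelfAdjoint (star n * n * c) ∧ ‖n - n * (star n * n * c)‖ < ε := by
  have hspec : ∀ t ∈ spectrum ℝ (star n * n), 0 ≤ t := spectrum_star_mul_self_nonneg
  set h := star n * n with hh
  have hsa : IsSelfAdjoint h := IsSelfAdjoint.star_mul_self n
  have hδ : 0 < ε ^ 2 := by positivity
  have hcont : ContinuousOn (fun t : ℝ => (t + ε ^ 2)⁻¹) (spectrum ℝ h) :=
    ContinuousOn.inv₀ (by fun_prop) fun t ht => by have := hspec t ht; positivity
  set g : ℝ → ℝ := fun t => 1 - t * (t + ε ^ 2)⁻¹ with hg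
  have hgc : ContinuousOn g (spectrum ℝ h) :=
    continuousOn_const.sub (continuousOn_id.mul hcont)
  have he : h * cfc (fun t : ℝ => (t + ε ^ 2)⁻¹) h = cfc (fun t : ℝ => t * (t + ε ^ 2)⁻¹) h := by
    rw [cfc_mul (fun t : ℝ => t) _ h continuousOn_id hcont, cfc_id' ℝ h]
  refine ⟨cfc (fun t : ℝ => (t + ε ^ 2)⁻¹) h, he ▸ cfc_predicate _ h, ?_⟩
  have hone : 1 - h * cfc (fun t : ℝ => (t + ε ^ 2)⁻¹) h = cfc g h := by
    rw [he, hg, cfc_sub (fun _ : ℝ => 1) (fun t : ℝ => t * (t + ε ^ 2)⁻¹) h continuousOn_const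
      (continuousOn_id.mul hcont), cfc_const_one ℝ h]
  have hgsa : star (cfc g h) = cfc g h := (cfc_predicate (p := IsSelfAdjoint) g h).star_eq
  have hfac : n - n * (h * cfc (fun t : ℝ => (t + ε ^ 2)⁻¹) h) = n * cfc g h := by
    rw [← hone, mul_sub, mul_one]
  have hsq : star (n * cfc g h) * (n * cfc g h) = cfc (fun t => g t * t * g t) h := by
    rw [cfc_mul (fun t => g t * t) g h (hgc.mul continuousOn_id) hgc,
      cfc_mul g (fun t => t) h hgc continuousOn_id, cfc_id' ℝ h, star_mul, hgsa, hh]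
    noncomm_ring
  have hle : ‖cfc (fun t => g t * t * g t) h‖ ≤ ε ^ 2 / 2 := by
    refine norm_cfc_le (by positivity) fun t ht => ?_
    have ht0 := hspec t ht
    have hpos : 0 < t + ε ^ 2 := by positivity
    have hgt : g t = ε ^ 2 / (t + ε ^ 2) := by
      simp only [hg]; field_simp; ring
    rw [Real.norm_of_nonneg (by rw [hgt]; positivity), hgt, div_mul_eq_mul_div,
      div_mul_div_comm, div_le_iff₀ (by positivity)]
    nlinarith [mul_nonneg hδ.le (sq_nonneg t), mul_nonneg hδ.le (sq_nonneg (ε ^ 2))]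
  rw [hfac]
  refine lt_of_pow_lt_pow_left₀ 2 hε.le ?_
  rw [sq, ← CStarRing.norm_star_mul_self, hsq]
  linarith

/-- A closed two-sided ideal of a C*-algebra is closed under the star operation. -/
lemma star_mem_of_isClosed_ideal {N : Set A} (hclosed : IsClosed N)
    (hl : ∀ a : A, ∀ n ∈ N, a * n ∈ N) (hr : ∀ a : A, ∀ n ∈ N, n * a ∈ N)
    {n : A} (hn : n ∈ N) : star n ∈ N := by
  rw [← hclosed.closure_eq, Metric.mem_closure_iff]
  intro ε hε
  obtain ⟨c, hsa, hc⟩ := exists_isSelfAdjoint_norm_sub_mul_lt n hε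
  refine ⟨star n * n * c * star n, hr _ _ (hr _ _ (hl _ _ hn)), ?_⟩
  rwa [dist_eq_norm, ← norm_star, star_sub, star_mul _ (star n), star_star, hsa.star_eq]

/-- A closed two-sided ideal of a C*-algebra has a contractive approximate unit. -/
lemma exists_approximateUnit_of_isClosed_ideal {N : Set A} (hclosed : IsClosed N)
    (hl : ∀ a : A, ∀ n ∈ N, a * n ∈ N) (hr : ∀ a : A, ∀ n ∈ N, n * a ∈ N)
    (hsmul : ∀ c : ℂ, ∀ n ∈ N, c • n ∈ N) (hadd : ∀ m ∈ N, ∀ n ∈ N, m + n ∈ N)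
    (hzero : (0 : A) ∈ N) :
    ∃ l : Filter A, l.NeBot ∧ (∀ᶠ e in l, e ∈ N ∧ ‖e‖ ≤ 1) ∧
      ∀ n ∈ N, Tendsto (fun e => n * e) l (𝓝 n) ∧ Tendsto (fun e => e * n) l (𝓝 n) := by
  let S : NonUnitalStarSubalgebra ℂ A :=
    { carrier := N
      add_mem' := fun ha hb => hadd _ ha _ hb
      zero_mem' := hzero
      mul_mem' := fun _ hb => hl _ _ hb
      smul_mem' := fun c _ ha => hsmul c _ ha
      star_mem' := fun ha => star_mem_of_isClosed_ideal hclosed hl hr ha }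
  have : IsClosed (S : Set A) := hclosed
  let : NonUnitalCStarAlgebra S := NonUnitalStarSubalgebra.nonUnitalCStarAlgebra S
  let := CStarAlgebra.spectralOrder S
  let := CStarAlgebra.spectralOrderedRing S
  have hU := CStarAlgebra.increasingApproximateUnit S
  have := hU.neBot
  refine ⟨(CStarAlgebra.approximateUnit S).map Subtype.val, inferInstance, ?_, fun n hn => ?_⟩
  · rw [eventually_map]
    filter_upwards [hU.eventually_norm] with e he
    exact ⟨e.2, he⟩
  · exact ⟨tendsto_map'_iff.2 ((continuous_subtype_val.tendsto _).comp
      (hU.tendsto_mul_left ⟨n, hn⟩)), tendsto_map'_iff.2 ((continuous_subtype_val.tendsto _).comp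
      (hU.tendsto_mul_right ⟨n, hn⟩))⟩

end ClosedIdeal

namespace CstarSeminorm

section Ring

variable {R : Type*} [NonUnitalRing R] [Module ℂ R] {st : R → R} (p : CstarSeminorm R st)

lemma map_zero : p.ν 0 = 0 := by simpa using p.smul_eq 0 0

lemma map_neg (x : R) : p.ν (-x) = p.ν x := by simpa using p.smul_eq (-1) x

end Ring

variable {A B : Type*} [CStarAlgebra A] [CStarAlgebra B]

lemma le_one_of_mem_unitary (p : CstarSeminorm A star) {u : A} (hu : u ∈ unitary A) :
    p.ν u ≤ 1 := by
  have h1 : p.ν 1 ≤ 1 := by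
    have h := p.cstar 1
    rw [star_one, one_mul] at h
    nlinarith [p.nonneg 1]
  have h := p.cstar u
  rw [Unitary.star_mul_self_of_mem hu] at h
  nlinarith [p.nonneg u]

/-- Every C*-seminorm on a unital C*-algebra is dominated by the norm. -/
lemma le_norm (p : CstarSeminorm A star) (a : A) : p.ν a ≤ ‖a‖ := by
  let _ := CStarAlgebra.spectralOrder A
  let _ := CStarAlgebra.spectralOrderedRing A
  have hcontr : ∀ h : A, IsSelfAdjoint h → ‖h‖ ≤ 1 → p.ν h ≤ 1 := by
    intro h hh hn
    let u := selfAdjoint.unitarySelfAddISMul ⟨h, hh⟩ hn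
    have hu : h = (2⁻¹ : ℂ) • ((u : A) + star (u : A)) := by
      have h1 : star (u : A) = h - Complex.I • CFC.sqrt (1 - h ^ 2) :=
        selfAdjoint.star_coe_unitarySelfAddISMul ⟨h, hh⟩ hn
      have h2 : (u : A) = h + Complex.I • CFC.sqrt (1 - h ^ 2) := rfl
      rw [h1, h2]
      module
    have h2 := p.add_le (u : A) (star (u : A))
    have h3 := p.le_one_of_mem_unitary u.2
    have h4 := p.le_one_of_mem_unitary (Unitary.star_mem u.2)
    rw [hu, p.smul_eq]
    norm_num
    linarith
  have hsa : ∀ h : A, IsSelfAdjoint h → p.ν h ≤ ‖h‖ := by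
    intro h hh
    obtain rfl | h0 := eq_or_ne h 0
    · simp [p.map_zero]
    have hpos := norm_pos_iff.2 h0
    have hs : IsSelfAdjoint (((‖h‖⁻¹ : ℝ) : ℂ) • h) := by
      rw [Complex.coe_smul]
      exact (IsSelfAdjoint.all _).smul hh
    have key := hcontr _ hs (by
      rw [norm_smul, Complex.norm_real, norm_inv, norm_norm, inv_mul_cancel₀ hpos.ne'])
    rw [p.smul_eq, Complex.norm_real, norm_inv, norm_norm, inv_mul_le_iff₀ hpos, mul_one] at key
    exact key
  refine le_of_sq_le_sq ?_ (norm_nonneg a)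
  rw [← p.cstar, sq, ← CStarRing.norm_star_mul_self]
  exact hsa _ (.star_mul_self a)

@[simp]
lemma _root_.tstar_tmul (a : A) (b : B) : tstar A B (a ⊗ₜ b) = star a ⊗ₜ star b := rfl

/-- The restriction of a C*-seminorm on `A ⊙ B` to `A ⊙ 1`. -/
def left (p : CstarSeminorm (A ⊗[ℂ] B) (tstar A B)) : CstarSeminorm A star where
  ν a := p.ν (a ⊗ₜ 1)
  nonneg a := p.nonneg _
  add_le a b := by rw [TensorProduct.add_tmul]; exact p.add_le _ _
  smul_eq c a := by rw [← TensorProduct.smul_tmul']; exact p.smul_eq _ _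
  mul_le a b := by simpa using p.mul_le (a ⊗ₜ 1) (b ⊗ₜ 1)
  cstar a := by simpa using p.cstar (a ⊗ₜ 1)

/-- The restriction of a C*-seminorm on `A ⊙ B` to `1 ⊙ B`. -/
def right (p : CstarSeminorm (A ⊗[ℂ] B) (tstar A B)) : CstarSeminorm B star where
  ν b := p.ν (1 ⊗ₜ b)
  nonneg b := p.nonneg _
  add_le a b := by rw [TensorProduct.tmul_add]; exact p.add_le _ _
  smul_eq c a := by rw [TensorProduct.tmul_smul]; exact p.smul_eq _ _
  mul_le a b := by simpa using p.mul_le (1 ⊗ₜ a) (1 ⊗ₜ b)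
  cstar a := by simpa using p.cstar (1 ⊗ₜ a)

lemma tmul_one_le (p : CstarSeminorm (A ⊗[ℂ] B) (tstar A B)) (a : A) : p.ν (a ⊗ₜ 1) ≤ ‖a‖ :=
  p.left.le_norm a

lemma tmul_le (p : CstarSeminorm (A ⊗[ℂ] B) (tstar A B)) (a : A) (b : B) :
    p.ν (a ⊗ₜ b) ≤ ‖a‖ * ‖b‖ := by
  have h : a ⊗ₜ[ℂ] b = (a ⊗ₜ 1) * (1 ⊗ₜ b) := by simp
  rw [h]
  exact (p.mul_le _ _).trans
    (mul_le_mul (p.left.le_norm a) (p.right.le_norm b) (p.nonneg _) (norm_nonneg _))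

lemma tendsto_span {ι : Type*} {l : Filter ι} {N : Set A} (p : CstarSeminorm (A ⊗[ℂ] B) (tstar A B))
    (T : ι → A →ₗ[ℂ] A) (hT : ∀ n ∈ N, Tendsto (fun e => T e n) l (𝓝 n)) {x : A ⊗[ℂ] B}
    (hx : x ∈ Submodule.span ℂ {y | ∃ n ∈ N, ∃ b : B, y = n ⊗ₜ[ℂ] b}) :
    Tendsto (fun e => p.ν ((T e).rTensor B x - x)) l (𝓝 0) := by
  induction hx using Submodule.span_induction with
  | mem y hy =>
    obtain ⟨n, hn, b, rfl⟩ := hy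
    have h := ((tendsto_iff_norm_sub_tendsto_zero.1 (hT n hn)).mul_const ‖b‖)
    rw [zero_mul] at h
    refine squeeze_zero (fun _ => p.nonneg _) (fun e => ?_) h
    rw [LinearMap.rTensor_tmul, ← TensorProduct.sub_tmul]
    exact p.tmul_le _ _
  | zero => simpa [p.map_zero] using tendsto_const_nhds
  | add y z _ _ hy hz =>
    have h := hy.add hz
    rw [add_zero] at h
    refine squeeze_zero (fun _ => p.nonneg _) (fun e => ?_) h
    rw [_root_.map_add, add_sub_add_comm]
    exact p.add_le _ _
  | smul c y _ hy =>
    have h := hy.const_mul ‖c‖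
    rw [mul_zero] at h
    refine h.congr fun e => ?_
    rw [_root_.map_smul, ← smul_sub, p.smul_eq]

end CstarSeminorm

section ModuleTensor

variable {𝔄 A B : Type*} [CStarAlgebra 𝔄] [CStarAlgebra A] [CStarAlgebra B]

/-- The subspace `N ⊙ B` of `A ⊙ B`. -/
def subTensor (B : Type*) [CStarAlgebra B] (N : Set A) : Submodule ℂ (A ⊗[ℂ] B) :=
  Submodule.span ℂ {y | ∃ n ∈ N, ∃ b : B, y = n ⊗ₜ[ℂ] b}

/-- The module ideal `I_{N,B}` of `N ⊙ B`. -/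
def subModuleIdeal (actA : CompatibleAction 𝔄 A) (actB : CompatibleAction 𝔄 B) (N : Set A) :
    Submodule ℂ (A ⊗[ℂ] B) :=
  Submodule.span ℂ {y | ∃ g ∈ {x | ∃ (α : 𝔄), ∃ n ∈ N, ∃ b : B,
        x = (actA.r n α) ⊗ₜ[ℂ] b - n ⊗ₜ[ℂ] (actB.l α b)},
    y = g ∨ (∃ u ∈ subTensor B N, y = u * g) ∨ (∃ v ∈ subTensor B N, y = g * v) ∨
      ∃ u ∈ subTensor B N, ∃ v ∈ subTensor B N, y = u * g * v}

lemma subModuleIdeal_le (actA : CompatibleAction 𝔄 A) (actB : CompatibleAction 𝔄 B) (N : Set A) :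
    subModuleIdeal actA actB N ≤ moduleIdeal actA actB := by
  refine Submodule.span_mono ?_
  rintro y ⟨g, ⟨α, n, -, b, rfl⟩, h⟩
  refine ⟨_, ⟨α, n, b, rfl⟩, ?_⟩
  rcases h with h | ⟨u, -, h⟩ | ⟨v, -, h⟩ | ⟨u, -, v, -, h⟩
  exacts [.inl h, .inr (.inl ⟨u, h⟩), .inr (.inr (.inl ⟨v, h⟩)), .inr (.inr (.inr ⟨u, v, h⟩))]

lemma mul_tmul_one_mem_subTensor {N : Set A} (hl : ∀ a : A, ∀ n ∈ N, a * n ∈ N) {e : A}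
    (he : e ∈ N) (v : A ⊗[ℂ] B) : v * (e ⊗ₜ 1) ∈ subTensor B N := by
  induction v using TensorProduct.induction_on with
  | zero => simp
  | tmul a b =>
    rw [Algebra.TensorProduct.tmul_mul_tmul, mul_one]
    exact Submodule.subset_span ⟨_, hl _ _ he, b, rfl⟩
  | add v w hv hw => rw [add_mul]; exact add_mem hv hw

lemma sandwich_mem_subModuleIdeal (actA : CompatibleAction 𝔄 A) (actB : CompatibleAction 𝔄 B)
    {N : Set A} (hl : ∀ a : A, ∀ n ∈ N, a * n ∈ N) (hr : ∀ a : A, ∀ n ∈ N, n * a ∈ N) {e : A}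
    (he : e ∈ N) {i : A ⊗[ℂ] B} (hi : i ∈ moduleIdeal actA actB) :
    (e ⊗ₜ 1) * (e ⊗ₜ 1) * i * (e ⊗ₜ 1) ∈ subModuleIdeal actA actB N := by
  have key : ∀ g ∈ tensorGens actA actB, ∀ u v : A ⊗[ℂ] B,
      (e ⊗ₜ 1) * (e ⊗ₜ 1) * (u * g * v) * (e ⊗ₜ 1) ∈ subModuleIdeal actA actB N := by
    rintro g ⟨α, a₀, b₀, rfl⟩ u v
    induction u using TensorProduct.induction_on with
    | zero => simp
    | tmul a b =>
      refine Submodule.subset_span ⟨_, ⟨α, e * a * a₀, hr _ _ (hr _ _ he), b₀, rfl⟩,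
        .inr (.inr (.inr ⟨e ⊗ₜ b, Submodule.subset_span ⟨e, he, b, rfl⟩, v * (e ⊗ₜ 1),
          mul_tmul_one_mem_subTensor hl he v, ?_⟩))⟩
      rw [← mul_assoc _ v, ← mul_assoc _ _ v]
      congr 2
      simp [mul_sub, actA.mul_r, mul_assoc]
    | add u w hu hw =>
      rw [add_mul, add_mul, mul_add, add_mul]
      exact add_mem hu hw
  induction hi using Submodule.span_induction with
  | mem y hy =>
    obtain ⟨g, hg, rfl | ⟨u, rfl⟩ | ⟨v, rfl⟩ | ⟨u, v, rfl⟩⟩ := hy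
    · simpa only [one_mul, mul_one] using key _ hg 1 1
    · simpa only [mul_one] using key _ hg u 1
    · simpa only [one_mul] using key _ hg 1 v
    · exact key _ hg u v
  | zero => simp
  | add y z _ _ hy hz =>
    rw [mul_add, add_mul]
    exact add_mem hy hz
  | smul c y _ hy =>
    rw [mul_smul_comm, smul_mul_assoc]
    exact Submodule.smul_mem _ c hy

lemma tendsto_sandwich {l : Filter A} (hle : ∀ᶠ e in l, ‖e‖ ≤ 1) {n : A}
    (hright : Tendsto (fun e => n * e) l (𝓝 n)) (hleft : Tendsto (fun e => e * n) l (𝓝 n)) :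
    Tendsto (fun e => e * e * n * e) l (𝓝 n) := by
  rw [tendsto_iff_norm_sub_tendsto_zero] at hright hleft ⊢
  have h := (hright.add hleft).add hleft
  rw [add_zero, add_zero] at h
  refine squeeze_zero' (.of_forall fun _ => norm_nonneg _) ?_ h
  filter_upwards [hle] with e he
  have hcontr : ∀ a : A, ‖e * a‖ ≤ ‖a‖ := fun a =>
    (norm_mul_le e a).trans (mul_le_of_le_one_left (norm_nonneg a) he)
  calc ‖e * e * n * e - n‖ = ‖e * (e * (n * e - n)) + e * (e * n - n) + (e * n - n)‖ := by
        congr 1; noncomm_ring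
    _ ≤ ‖e * (e * (n * e - n))‖ + ‖e * (e * n - n)‖ + ‖e * n - n‖ := norm_add₃_le
    _ ≤ ‖n * e - n‖ + ‖e * n - n‖ + ‖e * n - n‖ :=
      add_le_add_left (add_le_add ((hcontr _).trans (hcontr _)) (hcontr _)) _

lemma rTensor_sandwich (e : A) (x : A ⊗[ℂ] B) :
    (LinearMap.mulRight ℂ e ∘ₗ LinearMap.mulLeft ℂ (e * e)).rTensor B x =
      (e ⊗ₜ 1) * (e ⊗ₜ 1) * x * (e ⊗ₜ 1) := by
  induction x using TensorProduct.induction_on with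
  | zero => simp
  | tmul a b => simp [mul_assoc]
  | add x y hx hy => rw [map_add, hx, hy, mul_add, add_mul]

lemma quotNorm_subModuleIdeal_eq (actA : CompatibleAction 𝔄 A) (actB : CompatibleAction 𝔄 B)
    {N : Set A} (hclosed : IsClosed N)
    (hl : ∀ a : A, ∀ n ∈ N, a * n ∈ N) (hr : ∀ a : A, ∀ n ∈ N, n * a ∈ N)
    (hsmul : ∀ c : ℂ, ∀ n ∈ N, c • n ∈ N) (hadd : ∀ m ∈ N, ∀ n ∈ N, m + n ∈ N)
    (hzero : (0 : A) ∈ N) (γ : CstarSeminorm (A ⊗[ℂ] B) (tstar A B))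
    {x : A ⊗[ℂ] B} (hx : x ∈ subTensor B N) :
    quotNorm γ.ν (subModuleIdeal actA actB N) x = quotNorm γ.ν (moduleIdeal actA actB) x := by
  have hbdd : ∀ I : Set (A ⊗[ℂ] B), BddBelow ((fun i => γ.ν (x + i)) '' I) := fun I =>
    ⟨0, by rintro _ ⟨i, -, rfl⟩; exact γ.nonneg _⟩
  refine le_antisymm (le_csInf ⟨_, 0, zero_mem _, rfl⟩ ?_)
    (csInf_le_csInf (hbdd _) ⟨_, 0, zero_mem _, rfl⟩
      (Set.image_mono (subModuleIdeal_le actA actB N)))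
  rintro _ ⟨i, hi, rfl⟩
  refine le_of_forall_pos_lt_add fun ε hε => ?_
  obtain ⟨l, _, hl1, hlim⟩ :=
    exists_approximateUnit_of_isClosed_ideal hclosed hl hr hsmul hadd hzero
  have htend := γ.tendsto_span
    (fun e : A => LinearMap.mulRight ℂ e ∘ₗ LinearMap.mulLeft ℂ (e * e))
    (fun n hn => tendsto_sandwich (hl1.mono fun _ h => h.2) (hlim n hn).1 (hlim n hn).2) hx
  obtain ⟨e, ⟨heN, he1⟩, hlt⟩ := (hl1.and (htend.eventually_lt_const hε)).exists
  rw [rTensor_sandwich] at hlt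
  set E : A ⊗[ℂ] B := e ⊗ₜ 1
  have hE : γ.ν E ≤ 1 := (γ.tmul_one_le e).trans he1
  have hcontr : γ.ν (E * E * (x + i) * E) ≤ γ.ν (x + i) := by
    refine (γ.mul_le _ _).trans ((mul_le_of_le_one_right (γ.nonneg _) hE).trans ?_)
    refine (γ.mul_le _ _).trans (mul_le_of_le_one_left (γ.nonneg _) ?_)
    exact (γ.mul_le _ _).trans (mul_le_one₀ hE (γ.nonneg _) hE)
  calc quotNorm γ.ν (subModuleIdeal actA actB N) x ≤ γ.ν (x + E * E * i * E) :=
        csInf_le (hbdd _) ⟨_, sandwich_mem_subModuleIdeal actA actB hl hr heN hi, rfl⟩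
    _ = γ.ν (E * E * (x + i) * E + -(E * E * x * E - x)) := by
        congr 1; rw [mul_add, add_mul]; abel
    _ ≤ γ.ν (E * E * (x + i) * E) + γ.ν (E * E * x * E - x) := by
        rw [← γ.map_neg (E * E * x * E - x)]; exact γ.add_le _ _
    _ < γ.ν (x + i) + ε := add_lt_add_of_le_of_lt hcontr hlt

end ModuleTensor

/-- For a closed two-sided ideal and `𝔄`-submodule `N` of `A`, the
canonical map `N ⊗_{𝔄,max} B → A ⊗_{𝔄,max} B` is an isometric embedding.  Here, using
the isometric inclusion `N ⊗_max B ⊆ A ⊗_max B` (Pisier), the max norm of `N ⊙ B` is the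
restriction of the max norm `γ` of `A ⊙ B` to the subalgebra `N ⊙ B`, and the claim is
that for `x ∈ N ⊙ B` the quotient norm by the ideal `I_{N,B}` of `N ⊙ B` coincides with
the quotient norm by the ideal `I_{A,B}` of `A ⊙ B`. -/
theorem ideal_moduleMaxTensor_isometric
    {𝔄 A B : Type*}
    [NormedRing 𝔄] [StarRing 𝔄] [CStarRing 𝔄] [NormedAlgebra ℂ 𝔄] [StarModule ℂ 𝔄]
    [CompleteSpace 𝔄]
    [NormedRing A] [StarRing A] [CStarRing A] [NormedAlgebra ℂ A] [StarModule ℂ A]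
    [CompleteSpace A]
    [NormedRing B] [StarRing B] [CStarRing B] [NormedAlgebra ℂ B] [StarModule ℂ B]
    [CompleteSpace B]
    (actA : CompatibleAction 𝔄 A) (actB : CompatibleAction 𝔄 B)
    (N : Set A) (hclosed : IsClosed N)
    (hideal_l : ∀ a : A, ∀ n ∈ N, a * n ∈ N) (hideal_r : ∀ a : A, ∀ n ∈ N, n * a ∈ N)
    (hsub : ∀ (c : ℂ), ∀ n ∈ N, c • n ∈ N) (hadd : ∀ m ∈ N, ∀ n ∈ N, m + n ∈ N)
    (hzero : (0 : A) ∈ N)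
    (hmodl : ∀ (α : 𝔄), ∀ n ∈ N, actA.l α n ∈ N)
    (hmodr : ∀ (α : 𝔄), ∀ n ∈ N, actA.r n α ∈ N)
    (γ : CstarSeminorm (A ⊗[ℂ] B) (tstar A B)) (hγ : γ.IsMax) :
    -- `N ⊙ B` as a subspace of `A ⊙ B`:
    letI NB : Submodule ℂ (A ⊗[ℂ] B) :=
      Submodule.span ℂ {y | ∃ n ∈ N, ∃ b : B, y = n ⊗ₜ[ℂ] b}
    -- the module ideal `I_{N,B}` of `N ⊙ B`:
    letI INB : Submodule ℂ (A ⊗[ℂ] B) :=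
      Submodule.span ℂ {y | ∃ g ∈ {x | ∃ (α : 𝔄), ∃ n ∈ N, ∃ b : B,
            x = (actA.r n α) ⊗ₜ[ℂ] b - n ⊗ₜ[ℂ] (actB.l α b)},
        y = g ∨ (∃ u ∈ NB, y = u * g) ∨ (∃ v ∈ NB, y = g * v) ∨
          ∃ u ∈ NB, ∃ v ∈ NB, y = u * g * v}
    ∀ x ∈ NB,
      quotNorm γ.ν INB x = quotNorm γ.ν (moduleIdeal actA actB) x := by
  let _ : CStarAlgebra 𝔄 := {}
  let _ : CStarAlgebra A := {}
  let _ : CStarAlgebra B := {}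
  intro x hx
  exact quotNorm_subModuleIdeal_eq actA actB hclosed hideal_l hideal_r hsub hadd hzero γ hx
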